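/- Let m ≥ 1, u ∈ ℝᵐ and t = |u|², and suppose α(t)φ(t) ≠ 0, α₁(t)·(α₁+α₃)(t) ≠ 0 and φ₁(t)·(φ₁+φ₃)(t) ≠ 0. Write M₁ = μ(α₁(t),β₁(t),u), M₂ = μ(α₂(t),β₂(t),u), M₁₃ = μ((α₁+α₃)(t),(β₁+β₃)(t),u), and Λ = (M₁₃ − M₂M₁⁻¹M₂)⁻¹. Then the matrix Θ = −M₁⁻¹M₂Λ has (i,j) entry −(α₂(t)/α(t))·δᵢⱼ − ψ_θ(t)·uⁱuʲ. -/

import Mathlib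

open Matrix

/-- The `m × m` real matrix with `(i,j)` entry `a·δᵢⱼ + b·uⁱuʲ`. -/
def mu {m : ℕ} (a b : ℝ) (u : Fin m → ℝ) : Matrix (Fin m) (Fin m) ℝ :=
  Matrix.of fun i j => a * (if i = j then (1 : ℝ) else 0) + b * u i * u j

theorem mu_mul_mu {m : ℕ} (a b c d : ℝ) (u : Fin m → ℝ) :
    mu a b u * mu c d u = mu (a * c) (a * d + b * c + (∑ i, u i ^ 2) * b * d) u := by
  have hmu (a b : ℝ) : mu a b u = a • (1 : Matrix (Fin m) (Fin m) ℝ) + b • vecMulVec u u := by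
    ext i j
    simp [mu, Matrix.one_apply, vecMulVec_apply, mul_assoc]
  have hu : vecMulVec u u * vecMulVec u u = (∑ i, u i ^ 2) • vecMulVec u u := by
    ext i j
    simp only [Matrix.mul_apply, vecMulVec_apply, Matrix.smul_apply, smul_eq_mul, Finset.sum_mul]
    exact Finset.sum_congr rfl fun k _ => by ring
  simp only [hmu, add_mul, mul_add, Matrix.smul_mul, Matrix.mul_smul, Matrix.one_mul,
    Matrix.mul_one, hu]
  module

theorem mu_one_zero {m : ℕ} (u : Fin m → ℝ) : mu 1 0 u = 1 := by
  ext i j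
  simp [mu, Matrix.one_apply]

theorem mu_sub_mu {m : ℕ} (a b c d : ℝ) (u : Fin m → ℝ) :
    mu a b u - mu c d u = mu (a - c) (b - d) u := by
  ext i j
  simp only [mu, Matrix.sub_apply, Matrix.of_apply]
  ring

theorem inv_mu {m : ℕ} {a b : ℝ} (u : Fin m → ℝ) (ha : a ≠ 0)
    (hab : a + (∑ i, u i ^ 2) * b ≠ 0) :
    (mu a b u)⁻¹ = mu (1 / a) (-b / (a * (a + (∑ i, u i ^ 2) * b))) u := by
  refine Matrix.inv_eq_right_inv ?_
  rw [mu_mul_mu, ← mu_one_zero u]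
  generalize ∑ i, u i ^ 2 = t at hab ⊢
  obtain ⟨s, hs⟩ : ∃ s, s = a + t * b := ⟨_, rfl⟩
  rw [← hs] at hab ⊢
  congr 1 <;> field_simp
  rw [hs]
  ring

theorem stmt4 (m : ℕ) (hm : 1 ≤ m) (α₁ α₂ α₃ β₁ β₂ β₃ : ℝ → ℝ)
    (u : Fin m → ℝ) (t : ℝ) (ht : t = ∑ i, u i ^ 2)
    (φ₁ φ₂ φ₃ A Φ : ℝ)
    (hφ₁ : φ₁ = α₁ t + t * β₁ t) (hφ₂ : φ₂ = α₂ t + t * β₂ t)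
    (hφ₃ : φ₃ = α₃ t + t * β₃ t)
    (hA : A = α₁ t * (α₁ t + α₃ t) - α₂ t ^ 2)
    (hΦ : Φ = φ₁ * (φ₁ + φ₃) - φ₂ ^ 2)
    (h1 : A * Φ ≠ 0) (h2 : α₁ t * (α₁ t + α₃ t) ≠ 0)
    (h3 : φ₁ * (φ₁ + φ₃) ≠ 0)
    (ψθ : ℝ)
    (hψθ : ψθ = (-(α₂ t) * ((β₁ t + β₃ t) * φ₁ - β₂ t * φ₂)
        + (α₁ t + α₃ t) * (α₁ t * β₂ t - α₂ t * β₁ t)) / (A * Φ))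
    (M₁ M₂ M₁₃ Lam Θ : Matrix (Fin m) (Fin m) ℝ)
    (hM₁ : M₁ = mu (α₁ t) (β₁ t) u)
    (hM₂ : M₂ = mu (α₂ t) (β₂ t) u)
    (hM₁₃ : M₁₃ = mu (α₁ t + α₃ t) (β₁ t + β₃ t) u)
    (hLam : Lam = (M₁₃ - M₂ * M₁⁻¹ * M₂)⁻¹)
    (hΘ : Θ = -(M₁⁻¹ * M₂ * Lam)) :
    ∀ i j, Θ i j =
      -(α₂ t / A) * (if i = j then (1 : ℝ) else 0) - ψθ * u i * u j := by
  have hA0 : A ≠ 0 := left_ne_zero_of_mul h1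
  have hΦ0 : Φ ≠ 0 := right_ne_zero_of_mul h1
  have ha₁ : α₁ t ≠ 0 := left_ne_zero_of_mul h2
  have hφ₁0 : φ₁ ≠ 0 := left_ne_zero_of_mul h3
  have hinv₁ : M₁⁻¹ = mu (1 / α₁ t) (-β₁ t / (α₁ t * φ₁)) u := by
    rw [hM₁, inv_mu u ha₁ (by rwa [← ht, ← hφ₁]), ← ht, ← hφ₁]
  obtain ⟨q, hq⟩ : ∃ q, q = ((β₁ t + β₃ t) * α₁ t * φ₁ - 2 * α₁ t * α₂ t * β₂ t
    - t * α₁ t * β₂ t ^ 2 + α₂ t ^ 2 * β₁ t) / (α₁ t * φ₁) := ⟨_, rfl⟩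
  have hSchur : M₁₃ - M₂ * M₁⁻¹ * M₂ = mu (A / α₁ t) q u := by
    rw [hinv₁, hM₂, hM₁₃, mu_mul_mu, mu_mul_mu, mu_sub_mu, ← ht]
    congr 1
    · rw [hA]
      field_simp
    · rw [hq]
      field_simp
      rw [hφ₁]
      ring
  have hsum : A / α₁ t + t * q = Φ / φ₁ := by
    rw [hq]
    field_simp
    rw [hA, hΦ, hφ₁, hφ₂, hφ₃]
    ring
  have hLam' : Lam = mu (α₁ t / A) (-q * α₁ t * φ₁ / (A * Φ)) u := by
    rw [hLam, hSchur, inv_mu u (div_ne_zero hA0 ha₁)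
      (by rw [← ht, hsum]; exact div_ne_zero hΦ0 hφ₁0), ← ht, hsum]
    congr 1 <;> field_simp
  have hprod : M₁⁻¹ * M₂ * Lam = mu (α₂ t / A) ψθ u := by
    rw [hinv₁, hM₂, hLam', mu_mul_mu, mu_mul_mu, ← ht]
    congr 1
    · field_simp
    · rw [hψθ, hq]
      field_simp
      rw [hΦ, hφ₁, hφ₂, hφ₃]
      ring
  intro i j
  rw [hΘ, hprod]
  simp only [mu, Matrix.neg_apply, Matrix.of_apply]
  ring
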